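/- arXiv:1909.10412 — 2 statements merged into one kernel-verified Lean document; each statement's English description precedes it below -/
import Mathlib

section
/- Let X be a nonempty set and n ≥ 2. An operation F : X^n → X is associative, quasitrivial, and has at most one neutral element if and only if F is reducible to an associative and quasitrivial binary operation G : X^2 → X. In that case, one may take G(x,y) = F(x, (n-1)·y) for all x, y ∈ X. -/
variable {X : Type*}

/-- The result of substituting `F` applied to the `n` consecutive entries starting at
position `i` of the `(2n-1)`-tuple `x` (given as the first `2n-1` values of `x : ℕ → X`),
and then applying `F` to the resulting `n`-tuple. -/
def naryCompAt (n : ℕ) (F : (Fin n → X) → X) (x : ℕ → X) (i : ℕ) : X :=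
  F fun j => if (j : ℕ) < i then x j
    else if (j : ℕ) = i then F (fun k => x (i + (k : ℕ)))
    else x ((j : ℕ) + n - 1)

/-- `F` is an associative `n`-ary operation. -/
def NAryAssociative (n : ℕ) (F : (Fin n → X) → X) : Prop :=
  ∀ (x : ℕ → X) (i : ℕ), i + 1 ≤ n - 1 → naryCompAt n F x i = naryCompAt n F x (i + 1)

/-- `e` is a neutral element for the `n`-ary operation `F`: inserting the argument `a` at
any position `p`, with `e` at all the other positions, returns `a`. -/
def NAryNeutral (n : ℕ) (F : (Fin n → X) → X) (e : X) : Prop :=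
  ∀ (a : X) (p : Fin n), F (Function.update (fun _ => e) p a) = a

/-- The set `E_F` of neutral elements for `F`. -/
def naryNeutralSet (n : ℕ) (F : (Fin n → X) → X) : Set X :=
  {e | NAryNeutral n F e}

/-- `e` is a neutral element for the restriction of `F` to `S^n`. -/
def NAryNeutralOn (n : ℕ) (F : (Fin n → X) → X) (S : Set X) (e : X) : Prop :=
  e ∈ S ∧ ∀ a ∈ S, ∀ p : Fin n, F (Function.update (fun _ => e) p a) = a

/-- `iterOp G m x = G (x 0) (G (x 1) (⋯ (G (x (m-1)) (x m))⋯))`,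
the `m`-fold iterate of the binary operation `G`, applied to `m+1` arguments. -/
def iterOp (G : X → X → X) : ℕ → (ℕ → X) → X
  | 0, x => x 0
  | m + 1, x => G (x 0) (iterOp G m fun i => x (i + 1))

/-- The `n`-ary operation `F` is reducible to the binary operation `G`, i.e. `F` is the
`(n-1)`-fold iterate of `G`. -/
def NAryReducibleTo (n : ℕ) (F : (Fin n → X) → X) (G : X → X → X) : Prop :=
  ∀ x : ℕ → X, F (fun i : Fin n => x i) = iterOp G (n - 1) x

/-- `gPow G a m` is the `G`-product of `m + 1` copies of `a`. -/
def gPow (G : X → X → X) (a : X) : ℕ → X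
  | 0 => a
  | m + 1 => G a (gPow G a m)

/-- `(Y, G)` is an Abelian group whose exponent divides `m` (for `m ≥ 1`): `G` maps `Y × Y`
into `Y` and is commutative and associative on `Y`, and `Y` contains a neutral element `e`
for which every element of `Y` has an inverse and such that the `G`-product of `m` copies of
any element of `Y` equals `e`. -/
def IsAbelianGroupOfExpDvdOn (Y : Set X) (G : X → X → X) (m : ℕ) : Prop :=
  (∀ a ∈ Y, ∀ b ∈ Y, G a b ∈ Y) ∧
  (∀ a ∈ Y, ∀ b ∈ Y, G a b = G b a) ∧
  (∀ a ∈ Y, ∀ b ∈ Y, ∀ c ∈ Y, G (G a b) c = G a (G b c)) ∧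
  ∃ e ∈ Y, (∀ a ∈ Y, G e a = a) ∧ (∀ a ∈ Y, ∃ b ∈ Y, G a b = e) ∧
    (∀ a ∈ Y, gPow G a (m - 1) = e)

/-- The tuple `x` lies in `D^n_k`: at least `k` of its components are equal to each other. -/
def MemD (n k : ℕ) (x : Fin n → X) : Prop :=
  ∃ S : Finset (Fin n), k ≤ S.card ∧ ∀ i ∈ S, ∀ j ∈ S, x i = x j

/-- `F` is quasitrivial on `D^n_k`. -/
def NAryQuasitrivialOnD (n k : ℕ) (F : (Fin n → X) → X) : Prop :=
  ∀ x : Fin n → X, MemD n k x → F x ∈ Set.range x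

/-- `F` is quasitrivial on `S^n_k`, the set of tuples taking at most `k` distinct values. -/
def NAryQuasitrivialOnS (n k : ℕ) (F : (Fin n → X) → X) : Prop :=
  ∀ x : Fin n → X, (Set.range x).encard ≤ k → F x ∈ Set.range x

/-- `F` is quasitrivial. -/
def NAryQuasitrivial (n : ℕ) (F : (Fin n → X) → X) : Prop :=
  ∀ x : Fin n → X, F x ∈ Set.range x

universe u

/-- A map `ι` into a monoid covers the `n`-ary operation `F` if it turns `F` into the
`n`-fold product. -/
def NAryCovers (n : ℕ) (F : (Fin n → X) → X) {M : Type*} [Monoid M] (ι : X → M) : Prop :=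
  ∀ x : ℕ → X, ι (F fun i => x i) = ((List.range n).map fun j => ι (x j)).prod

theorem NAryCovers.map_update {n : ℕ} {F : (Fin n → X) → X} {M : Type*} [Monoid M] {ι : X → M}
    (h : NAryCovers n F ι) (a b : X) (p : Fin n) :
    ι (F (Function.update (fun _ => a) p b)) =
      ι a ^ (p : ℕ) * ι b * ι a ^ (n - 1 - (p : ℕ)) := by
  have h₁ : Function.update (fun _ => a) p b =
      fun i : Fin n => Function.update (fun _ : ℕ => a) p b i := by
    funext i
    simp [Function.update_apply, Fin.ext_iff]
  have h₂ : List.range n = List.range (p + 1 + (n - 1 - p)) := by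
    congr 1
    omega
  have h₃ : (List.range (p : ℕ)).map (fun j => ι (Function.update (fun _ : ℕ => a) p b j)) =
      List.replicate p (ι a) := by
    rw [← List.length_range (n := (p : ℕ)), List.eq_replicate_iff]
    simp only [List.length_map, List.length_range, List.mem_map, List.mem_range, true_and]
    rintro _ ⟨j, hj, rfl⟩
    rw [Function.update_of_ne hj.ne]
  have h₄ : (List.range (n - 1 - p)).map
      (fun j => ι (Function.update (fun _ : ℕ => a) p b (p + 1 + j))) =
      List.replicate (n - 1 - p) (ι a) := by
    rw [List.eq_replicate_iff]
    simp only [List.length_map, List.length_range, List.mem_map, true_and]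
    rintro _ ⟨j, hj, rfl⟩
    rw [Function.update_of_ne (by omega)]
  rw [h₁, h, h₂, List.range_add, List.map_append, List.prod_append, List.range_succ,
    List.map_append, List.prod_append, h₃, List.map_map]
  simp only [Function.comp_def, h₄]
  simp

theorem NAryCovers.map_naryCompAt {n : ℕ} {F : (Fin n → X) → X} {M : Type*} [Monoid M]
    {ι : X → M} (h : NAryCovers n F ι) (x : ℕ → X) {i : ℕ} (hi : i < n) :
    ι (naryCompAt n F x i) = ((List.range (2 * n - 1)).map fun j => ι (x j)).prod := by
  obtain ⟨r, rfl⟩ : ∃ r, n = i + 1 + r := ⟨n - (i + 1), by omega⟩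
  have h₁ : 2 * (i + 1 + r) - 1 = i + (i + 1 + r) + r := by omega
  have h₂ := h fun k => x (i + k)
  unfold naryCompAt
  rw [h fun j => if j < i then x j else if j = i then F (fun k => x (i + (k : ℕ)))
    else x (j + (i + 1 + r) - 1), h₁, List.range_add, List.range_add (n := i + (i + 1 + r)),
    List.range_add (n := i) (m := i + 1 + r), List.range_succ]
  simp only [List.map_append, List.prod_append, List.map_map, Function.comp_def]
  congr 1
  · congr 1
    · congr 1
      refine List.map_congr_left fun j hj => ?_
      simp [List.mem_range.1 hj]
    · simp [h₂]
  · congr 1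
    refine List.map_congr_left fun j _ => ?_
    rw [if_neg (by omega), if_neg (by omega)]
    congr 2
    omega

theorem NAryCovers.associative {n : ℕ} {F : (Fin n → X) → X} {M : Type*} [Monoid M]
    {ι : X → M} (h : NAryCovers n F ι) (hι : Function.Injective ι) : NAryAssociative n F := by
  intro x i hi
  apply hι
  rw [h.map_naryCompAt x (by omega), h.map_naryCompAt x (by omega)]

/-! ### The covering monoid of an associative operation -/

/-- `F` applied to a list, padded with `d`. -/
def naryListApply (n : ℕ) (F : (Fin n → X) → X) (d : X) (l : List X) : X :=
  F fun i => (l[(i : ℕ)]?).getD d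

/-- The right-nested `F`-product of a list of length `1 + k * (n - 1)`;
it is `none` for lists of other lengths. -/
def naryEval (n : ℕ) (F : (Fin n → X) → X) (d : X) (l : List X) : Option X :=
  if l.length = 1 then l.head?
  else if l.length ≤ n - 1 ∨ n ≤ 1 then none
  else (naryEval n F d (l.drop (n - 1))).map
    fun a => naryListApply n F d (l.take (n - 1) ++ [a])
termination_by l.length
decreasing_by
  rw [List.length_drop]
  omega

theorem naryCompAt_getD {n : ℕ} (F : (Fin n → X) → X) (d : X) {p u q : List X}
    (hu : u.length = n) :
    naryCompAt n F (fun j => ((p ++ u ++ q)[j]?).getD d) p.length =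
      naryListApply n F d (p ++ naryListApply n F d u :: q) := by
  unfold naryCompAt
  conv_rhs => unfold naryListApply
  congr 1
  funext j
  split_ifs with h₁ h₂
  · simp only [List.append_assoc]
    rw [List.getElem?_append_left h₁, List.getElem?_append_left h₁]
  · rw [h₂, List.getElem?_append_right le_rfl]
    simp only [Nat.sub_self, List.getElem?_cons_zero, Option.getD_some]
    congr 1
    funext k
    simp only [List.append_assoc]
    rw [List.getElem?_append_right (by omega), Nat.add_sub_cancel_left,
      List.getElem?_append_left (by omega)]
  · have h₃ : (j : ℕ) - p.length = (j - p.length - 1) + 1 := by omega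
    beta_reduce
    rw [List.getElem?_append_right (l₁ := p ++ u) (by rw [List.length_append]; omega),
      List.getElem?_append_right (l₁ := p) (by omega), h₃, List.getElem?_cons_succ]
    congr 2
    rw [List.length_append]
    omega

theorem NAryAssociative.naryCompAt_eq {n : ℕ} {F : (Fin n → X) → X} (h : NAryAssociative n F)
    (x : ℕ → X) {i : ℕ} (hi : i ≤ n - 1) : naryCompAt n F x i = naryCompAt n F x 0 := by
  induction i with
  | zero => rfl
  | succ i ih => rw [← h x i hi, ih (by omega)]

theorem NAryAssociative.naryListApply_eq {n : ℕ} {F : (Fin n → X) → X}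
    (h : NAryAssociative n F) (d : X) {p u q p' u' q' : List X} (hu : u.length = n)
    (hu' : u'.length = n) (hp : p.length ≤ n - 1) (hp' : p'.length ≤ n - 1)
    (e : p ++ u ++ q = p' ++ u' ++ q') :
    naryListApply n F d (p ++ naryListApply n F d u :: q) =
      naryListApply n F d (p' ++ naryListApply n F d u' :: q') := by
  rw [← naryCompAt_getD F d hu, ← naryCompAt_getD F d hu', e, h.naryCompAt_eq _ hp,
    h.naryCompAt_eq _ hp']

theorem naryEval_singleton {n : ℕ} (F : (Fin n → X) → X) (d a : X) :
    naryEval n F d [a] = some a := by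
  rw [naryEval]
  simp

theorem naryEval_eq_none {n : ℕ} (F : (Fin n → X) → X) (d : X) {l : List X}
    (h₁ : l.length ≠ 1) (h₂ : l.length ≤ n - 1) : naryEval n F d l = none := by
  rw [naryEval, if_neg h₁, if_pos (Or.inl h₂)]

theorem naryEval_append {n : ℕ} (hn : 2 ≤ n) (F : (Fin n → X) → X) (d : X) {p q : List X}
    (hp : p.length = n - 1) (hq : 1 ≤ q.length) :
    naryEval n F d (p ++ q) =
      (naryEval n F d q).map fun a => naryListApply n F d (p ++ [a]) := by
  rw [naryEval, if_neg (by rw [List.length_append]; omega),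
    if_neg (by rw [List.length_append]; omega), ← hp, List.drop_left, List.take_left]

theorem NAryAssociative.naryEval_replace {n : ℕ} (hn : 2 ≤ n) {F : (Fin n → X) → X}
    (h : NAryAssociative n F) (d : X) {u : List X} (hu : u.length = n) (q : List X) :
    ∀ (k : ℕ) (p : List X), p.length ≤ k →
      naryEval n F d (p ++ u ++ q) = naryEval n F d (p ++ naryListApply n F d u :: q) := by
  intro k
  induction k using Nat.strong_induction_on with
  | _ k ih =>
  intro p hpk
  rcases le_or_gt (n - 1) p.length with hp | hp
  · have h₁ : (p.take (n - 1)).length = n - 1 := by simp [hp]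
    rw [← List.take_append_drop (n - 1) p]
    simp only [List.append_assoc]
    rw [naryEval_append hn F d h₁ (by simp only [List.length_append]; omega),
      naryEval_append hn F d h₁ (by simp only [List.length_append, List.length_cons]; omega), ← List.append_assoc,
      ih (k - 1) (by omega) (p.drop (n - 1)) (by rw [List.length_drop]; omega)]
  · obtain ⟨u₁, u₂, rfl, hu₁⟩ : ∃ u₁ u₂, u = u₁ ++ u₂ ∧ p.length + u₁.length = n - 1 :=
      ⟨u.take (n - 1 - p.length), u.drop (n - 1 - p.length), by simp, by
        rw [List.length_take]; omega⟩
    rw [List.length_append] at hu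
    have hl : (p ++ u₁).length = n - 1 := by rw [List.length_append, hu₁]
    have h₁ : p ++ (u₁ ++ u₂) ++ q = (p ++ u₁) ++ (u₂ ++ q) := by simp
    rw [h₁, naryEval_append hn F d hl (by rw [List.length_append]; omega)]
    rcases le_or_gt (n - 1) (p.length + q.length) with hq | hq
    · obtain ⟨q₁, q₂, rfl, hq₁⟩ : ∃ q₁ q₂, q = q₁ ++ q₂ ∧ p.length + 1 + q₁.length = n - 1 :=
        ⟨q.take (n - 2 - p.length), q.drop (n - 2 - p.length), by simp, by
          rw [List.length_take]; omega⟩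
      rw [List.length_append] at hq
      have h₂ : p ++ naryListApply n F d (u₁ ++ u₂) :: (q₁ ++ q₂) =
        (p ++ naryListApply n F d (u₁ ++ u₂) :: q₁) ++ q₂ := by simp
      rw [h₂, ← List.append_assoc u₂,
        naryEval_append hn F d (by rw [List.length_append]; omega) (by omega),
        naryEval_append hn F d (by rw [List.length_append, List.length_cons]; omega) (by omega),
        Option.map_map]
      congr 1
      funext b
      have h₃ := h.naryListApply_eq d (p := p ++ u₁) (u := u₂ ++ q₁ ++ [b]) (q := [])
        (p' := p) (u' := u₁ ++ u₂) (q' := q₁ ++ [b])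
        (by simp only [List.length_append, List.length_singleton]; omega)
        (by rw [List.length_append]; omega) hl.le hp.le (by simp)
      simpa using h₃
    · rcases Nat.eq_zero_or_pos (p.length + q.length) with h₀ | h₀
      · obtain rfl : p = [] := List.eq_nil_of_length_eq_zero (by omega)
        obtain rfl : q = [] := List.eq_nil_of_length_eq_zero (by omega)
        obtain ⟨b, rfl⟩ : ∃ b, u₂ = [b] :=
          List.length_eq_one_iff.1 (by rw [List.length_nil] at hu₁; omega)
        simp [naryEval_singleton]
      · rw [naryEval_eq_none F d (l := u₂ ++ q) (by rw [List.length_append]; omega)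
          (by rw [List.length_append]; omega),
          naryEval_eq_none F d (by rw [List.length_append, List.length_cons]; omega)
          (by rw [List.length_append, List.length_cons]; omega)]
        rfl

/-- The syntactic congruence of a function on a free monoid. -/
def syntacticCon {Y : Type*} (f : FreeMonoid X → Y) : Con (FreeMonoid X) where
  r u v := ∀ p q, f (p * u * q) = f (p * v * q)
  iseqv := ⟨fun _ _ _ => rfl, fun h p q => (h p q).symm, fun h h' p q => (h p q).trans (h' p q)⟩
  mul' {u v u' v'} h h' p q := by
    have h₁ := h p (u' * q)
    have h₂ := h' (p * v) q
    simp only [mul_assoc] at h₁ h₂ ⊢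
    rw [h₁, h₂]

theorem NAryAssociative.exists_covers {X : Type*} [Nonempty X] {n : ℕ} (hn : 2 ≤ n)
    {F : (Fin n → X) → X} (h : NAryAssociative n F) :
    ∃ (c : Con (FreeMonoid X)) (ι : X → c.Quotient), Function.Injective ι ∧
      NAryCovers n F ι := by
  obtain ⟨d⟩ := ‹Nonempty X›
  let c : Con (FreeMonoid X) := syntacticCon fun w => naryEval n F d w.toList
  refine ⟨c, fun a => (FreeMonoid.of a : c.Quotient), fun a b hab => ?_, fun x => ?_⟩
  · have h₁ := (Con.eq c).1 hab 1 1
    simpa [naryEval_singleton] using h₁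
  · have h₁ : (((List.range n).map fun j => (FreeMonoid.of (x j) : c.Quotient))).prod =
        ((((List.range n).map fun j => FreeMonoid.of (x j)).prod : FreeMonoid X) :
          c.Quotient) := by
      change _ = c.mk' _
      rw [map_list_prod, List.map_map]
      rfl
    have h₂ : ((List.range n).map fun j => FreeMonoid.of (x j)).prod =
        FreeMonoid.ofList ((List.range n).map x) := by
      induction List.range n with
      | nil => rfl
      | cons a l ih => rw [List.map_cons, List.prod_cons, ih]; rfl
    have h₃ : (F fun i => x i) = naryListApply n F d ((List.range n).map x) := by
      unfold naryListApply
      congr 1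
      funext i
      simp
    rw [h₁, h₂, h₃, Con.eq]
    intro p q
    have h₄ := h.naryEval_replace hn d (u := (List.range n).map x) (by simp) q.toList
      p.toList.length p.toList le_rfl
    simpa using h₄.symm

/-! ### Products of two elements in the covering monoid -/

theorem mul_pow_eq_pow_succ {M : Type*} [Monoid M] {a b : M} (h : a * b = a * a) (k : ℕ) :
    a * b ^ k = a ^ (k + 1) := by
  induction k with
  | zero => simp
  | succ k ih => rw [pow_succ, ← mul_assoc, ih, pow_succ, mul_assoc, h, ← mul_assoc, ← pow_succ,
      ← pow_succ]

theorem NAryCovers.pow_eq {n : ℕ} (hn : 2 ≤ n) {F : (Fin n → X) → X} {M : Type*} [Monoid M]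
    {ι : X → M} (h : NAryCovers n F ι) (hq : NAryQuasitrivial n F) (x : X) :
    ι x ^ (n - 1 + 1) = ι x := by
  obtain ⟨i, hi⟩ := hq fun _ => x
  have h₁ := h fun _ => x
  rw [← hi] at h₁
  rw [Nat.sub_add_cancel (by omega)]
  simpa using h₁.symm

theorem NAryCovers.pow_mul_pow_mem {n : ℕ} {F : (Fin n → X) → X} {M : Type*} [Monoid M]
    {ι : X → M} (h : NAryCovers n F ι) (hq : NAryQuasitrivial n F) (x y : X) {k : ℕ}
    (hk : k < n) :
    ι x ^ k * ι y * ι x ^ (n - 1 - k) = ι x ∨ ι x ^ k * ι y * ι x ^ (n - 1 - k) = ι y := by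
  rw [← h.map_update x y ⟨k, hk⟩]
  obtain ⟨i, hi⟩ := hq (Function.update (fun _ => x) ⟨k, hk⟩ y)
  rw [← hi, Function.update_apply]
  split_ifs <;> simp

theorem NAryCovers.neutral_of_pow_eq {n : ℕ} (hn : 2 ≤ n) {F : (Fin n → X) → X} {M : Type*}
    [Monoid M] {ι : X → M} (h : NAryCovers n F ι) (hι : Function.Injective ι)
    (hq : NAryQuasitrivial n F) {x y : X} (hxy : x ≠ y)
    (e : ι x ^ (n - 1) = ι y ^ (n - 1)) : NAryNeutral n F x := by
  have hl (z : X) : ι x ^ (n - 1) * ι z = ι z := by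
    have h₁ := h.pow_mul_pow_mem hq x z (k := n - 1) (by omega)
    have h₂ := h.pow_mul_pow_mem hq y z (k := n - 1) (by omega)
    rw [← e] at h₂
    simp only [Nat.sub_self, pow_zero, mul_one] at h₁ h₂
    rcases h₁ with h₁ | h₁
    · rcases h₂ with h₂ | h₂
      · exact absurd (hι (h₁.symm.trans h₂)) hxy
      · exact h₂
    · exact h₁
  have hr (z : X) : ι z * ι x ^ (n - 1) = ι z := by
    have h₁ := h.pow_mul_pow_mem hq x z (k := 0) (by omega)
    have h₂ := h.pow_mul_pow_mem hq y z (k := 0) (by omega)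
    simp only [Nat.sub_zero, pow_zero, one_mul] at h₁ h₂
    rw [← e] at h₂
    rcases h₁ with h₁ | h₁
    · rcases h₂ with h₂ | h₂
      · exact absurd (hι (h₁.symm.trans h₂)) hxy
      · exact h₂
    · exact h₁
  intro z p
  apply hι
  rw [h.map_update]
  rcases h.pow_mul_pow_mem hq x z p.isLt with h₁ | h₁
  · rw [h₁]
    have h₂ : ι x ^ (n - 1 - (p : ℕ)) *
        (ι x ^ (p : ℕ) * ι z * ι x ^ (n - 1 - (p : ℕ))) * ι x ^ (p : ℕ) =
        ι x ^ (n - 1 - (p : ℕ)) * ι x * ι x ^ (p : ℕ) := by rw [h₁]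
    have hp : n - 1 - (p : ℕ) + p = n - 1 := by omega
    have h₃ : ι x ^ (n - 1 - (p : ℕ)) *
        (ι x ^ (p : ℕ) * ι z * ι x ^ (n - 1 - (p : ℕ))) * ι x ^ (p : ℕ) = ι z := by
      simp only [mul_assoc]
      rw [← pow_add, hp, hr, ← mul_assoc, ← pow_add, hp, hl]
    have h₄ : ι x ^ (n - 1 - (p : ℕ)) * ι x * ι x ^ (p : ℕ) = ι x := by
      rw [← pow_succ, ← pow_add, show n - 1 - (p : ℕ) + 1 + p = n - 1 + 1 by omega,
        h.pow_eq hn hq]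
    rw [← h₄, ← h₂, h₃]
  · exact h₁

theorem NAryCovers.pow_mul_eq_mul_pow {n : ℕ} (hn : 2 ≤ n) {F : (Fin n → X) → X} {M : Type*}
    [Monoid M] {ι : X → M} (h : NAryCovers n F ι) (hι : Function.Injective ι)
    (hq : NAryQuasitrivial n F) (hs : (naryNeutralSet n F).Subsingleton) (x y : X) :
    ι x ^ (n - 1) * ι y = ι x * ι y ^ (n - 1) := by
  have h₁ := h.pow_mul_pow_mem hq x y (k := n - 1) (by omega)
  have h₂ := h.pow_mul_pow_mem hq y x (k := 0) (by omega)
  have hx := h.pow_eq hn hq x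
  simp only [Nat.sub_self, Nat.sub_zero, pow_zero, one_mul, mul_one] at h₁ h₂
  rcases h₁ with h₁ | h₁
  · have h₃ : ι x * ι y = ι x * ι x := by
      conv_lhs => rw [← hx, pow_succ', mul_assoc, h₁]
    rw [h₁, mul_pow_eq_pow_succ h₃, hx]
  · rcases h₂ with h₂ | h₂
    · rw [h₁, h₂]
    · by_contra hne
      have hxy : x ≠ y := by
        rintro rfl
        exact hne (by rw [← pow_succ, ← pow_succ'])
      obtain ⟨m, hm⟩ : ∃ m, n - 1 = m + 1 := ⟨n - 2, by omega⟩
      have e : ι x ^ (n - 1) = ι y ^ (n - 1) := by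
        have h₃ : ι x ^ (n - 1) * ι y ^ (n - 1) = ι y ^ (n - 1) := by
          nth_rw 2 [hm]
          rw [pow_succ', ← mul_assoc, h₁, ← pow_succ', hm]
        have h₄ : ι x ^ (n - 1) * ι y ^ (n - 1) = ι x ^ (n - 1) := by
          nth_rw 1 [hm]
          rw [pow_succ, mul_assoc, h₂, ← pow_succ, hm]
        rw [← h₄, h₃]
      exact hxy (hs (h.neutral_of_pow_eq hn hι hq hxy e)
        (h.neutral_of_pow_eq hn hι hq hxy.symm e.symm))

/-! ### Operations covered by a quasitrivial semigroup -/

theorem iterOp_mem {G : X → X → X} (hG : ∀ a b, G a b = a ∨ G a b = b) (m : ℕ) (x : ℕ → X) :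
    ∃ j ≤ m, iterOp G m x = x j := by
  induction m generalizing x with
  | zero => exact ⟨0, le_rfl, rfl⟩
  | succ m ih =>
    obtain ⟨j, hj, e⟩ := ih fun i => x (i + 1)
    rcases hG (x 0) (iterOp G m fun i => x (i + 1)) with h | h
    · exact ⟨0, by omega, h⟩
    · exact ⟨j + 1, by omega, h.trans e⟩

theorem prod_range_eq_iterOp_pow {M : Type*} [Monoid M] {ι : X → M} {G : X → X → X}
    (hG : ∀ a b, ι a * ι b = ι (G a b) * ι (G a b)) (hG' : ∀ a b, G a b = a ∨ G a b = b)
    (m : ℕ) (x : ℕ → X) :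
    ((List.range (m + 1)).map fun j => ι (x j)).prod = ι (iterOp G m x) ^ (m + 1) := by
  induction m generalizing x with
  | zero => simp [iterOp]
  | succ m ih =>
    have h₁ := hG (x 0) (iterOp G m fun i => x (i + 1))
    rw [List.range_succ_eq_map, List.map_cons, List.prod_cons, List.map_map]
    have h₂ := ih fun i => x (i + 1)
    simp only [Function.comp_def, Nat.succ_eq_add_one]
    rw [h₂, iterOp]
    rcases hG' (x 0) (iterOp G m fun i => x (i + 1)) with h | h
    · rw [h] at h₁ ⊢
      exact mul_pow_eq_pow_succ h₁ _
    · rw [h] at h₁ ⊢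
      rw [pow_succ', ← mul_assoc, h₁, mul_assoc, ← pow_succ', ← pow_succ']

theorem NAryReducibleTo.quasitrivial {n : ℕ} (hn : 2 ≤ n) {F : (Fin n → X) → X}
    {G : X → X → X} (hr : NAryReducibleTo n F G) (hG : ∀ a b, G a b = a ∨ G a b = b) :
    NAryQuasitrivial n F := by
  intro x
  have h₁ := hr fun i => if h : i < n then x ⟨i, h⟩ else x ⟨0, by omega⟩
  simp only [Fin.is_lt, dite_true, Fin.eta] at h₁
  obtain ⟨j, hj, e⟩ := iterOp_mem hG (n - 1)
    fun i => if h : i < n then x ⟨i, h⟩ else x ⟨0, by omega⟩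
  rw [h₁, e, dif_pos (by omega)]
  exact ⟨_, rfl⟩

theorem NAryReducibleTo.exists_covers {X : Type u} {n : ℕ} (hn : 2 ≤ n) {F : (Fin n → X) → X}
    {G : X → X → X} (hr : NAryReducibleTo n F G) (ha : ∀ a b c, G (G a b) c = G a (G b c)) :
    ∃ (M : Type u) (_ : Monoid M) (ι : X → M), Function.Injective ι ∧
      NAryCovers n F ι ∧ ∀ a b, ι a * ι b = ι (G a b) := by
  let _ : Semigroup X := { mul := G, mul_assoc := ha }
  refine ⟨WithOne X, inferInstance, fun a => (a : WithOne X), WithOne.coe_injective,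
    fun x => ?_, fun a b => rfl⟩
  have h₁ (m : ℕ) (x : ℕ → X) : ((iterOp G m x : X) : WithOne X) =
      ((List.range (m + 1)).map fun j => (x j : WithOne X)).prod := by
    induction m generalizing x with
    | zero => simp [iterOp]
    | succ m ih =>
      rw [List.range_succ_eq_map, List.map_cons, List.prod_cons, List.map_map]
      simp only [Function.comp_def, Nat.succ_eq_add_one]
      rw [← ih fun i => x (i + 1)]
      rfl
  have h₂ := h₁ (n - 1) x
  rw [Nat.sub_add_cancel (by omega)] at h₂
  simp only [hr x, h₂]

/-- `F` is associative, quasitrivial and has at most one neutral element iff it is reducible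
to an associative quasitrivial binary operation `G`; in that case
`G (x, y) = F (x, (n-1)·y)`. -/
theorem stmt_1 {X : Type*} [Nonempty X] (n : ℕ) (hn : 2 ≤ n)
    (F : (Fin n → X) → X) :
    ((NAryAssociative n F ∧ NAryQuasitrivial n F ∧
        (naryNeutralSet n F).Subsingleton) ↔
      ∃ G : X → X → X, (∀ a b c, G (G a b) c = G a (G b c)) ∧
        (∀ a b, G a b = a ∨ G a b = b) ∧ NAryReducibleTo n F G) ∧
    (∀ G : X → X → X, (∀ a b c, G (G a b) c = G a (G b c)) →
      (∀ a b, G a b = a ∨ G a b = b) → NAryReducibleTo n F G →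
      ∀ x y : X, G x y =
        F (Function.update (fun _ => y) (⟨0, by omega⟩ : Fin n) x)) := by
  refine ⟨⟨?_, ?_⟩, ?_⟩
  · rintro ⟨ha, hq, hs⟩
    obtain ⟨c, ι, hι, h⟩ := ha.exists_covers hn
    let G : X → X → X := fun x y => F (Function.update (fun _ => y) (⟨0, by omega⟩ : Fin n) x)
    have hG₁ (x y : X) : ι (G x y) = ι x * ι y ^ (n - 1) := by
      simpa using h.map_update y x ⟨0, by omega⟩
    have hG₂ (x y : X) : ι (G x y) = ι x ^ (n - 1) * ι y := by
      rw [hG₁, h.pow_mul_eq_mul_pow hn hι hq hs]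
    have hG₃ (x y : X) : G x y = x ∨ G x y = y := by
      have h₁ := h.pow_mul_pow_mem hq y x (k := 0) (by omega)
      simp only [pow_zero, one_mul, Nat.sub_zero, ← hG₁] at h₁
      exact h₁.symm.imp (fun e => hι e) (fun e => hι e)
    have hG₄ (x y : X) : ι x * ι y = ι (G x y) * ι (G x y) := by
      rcases hG₃ x y with e | e
      · have h₁ := hG₂ x y
        rw [e] at h₁ ⊢
        conv_lhs => rw [← h.pow_eq hn hq x, pow_succ', mul_assoc, ← h₁]
      · have h₁ := hG₁ x y
        rw [e] at h₁ ⊢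
        conv_lhs => rw [← h.pow_eq hn hq y, pow_succ, ← mul_assoc, ← h₁]
    refine ⟨G, fun x y z => hι ?_, hG₃, fun x => hι ?_⟩
    · rw [hG₁, hG₂, hG₂, hG₁, mul_assoc]
    · have h₁ := prod_range_eq_iterOp_pow hG₄ hG₃ (n - 1) x
      rw [h.pow_eq hn hq, Nat.sub_add_cancel (by omega)] at h₁
      rw [h, h₁]
  · rintro ⟨G, ha, hG, hr⟩
    obtain ⟨M, _, ι, hι, h, hm⟩ := hr.exists_covers hn ha
    have hid (a : X) : IsIdempotentElem (ι a) := by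
      rw [IsIdempotentElem, hm]
      rcases hG a a with e | e <;> rw [e]
    refine ⟨h.associative hι, hr.quasitrivial hn hG, fun e he e' he' => hι ?_⟩
    have h₁ := h.map_update e e' ⟨n - 1, by omega⟩
    have h₂ := h.map_update e' e ⟨0, by omega⟩
    rw [he, Nat.sub_self, pow_zero, mul_one, (hid e).pow_eq (show n - 1 ≠ 0 by omega)] at h₁
    rw [he', Nat.sub_zero, pow_zero, one_mul, (hid e').pow_eq (by omega)] at h₂
    rw [h₂, ← h₁]
  · intro G ha hG hr x y
    obtain ⟨M, _, ι, hι, h, hm⟩ := hr.exists_covers hn ha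
    have hid : IsIdempotentElem (ι y) := by
      rw [IsIdempotentElem, hm]
      rcases hG y y with e | e <;> rw [e]
    apply hι
    rw [h.map_update, Nat.sub_zero, pow_zero, one_mul, hid.pow_eq (by omega), hm]
end

section
/- Let X be a nonempty set, n ≥ 3, and let F : X^n → X be associative with E_F nonempty. Then F preserves E_F: for all e_1,…,e_n ∈ E_F, the element F(e_1,…,e_n) is again a neutral element for F, i.e., F(E_F^n) ⊆ E_F. -/
variable {X : Type*}

/-- The element `e` is neutral for the binary operation `(a, b) ↦ F (a, b, e, …, e)`, and `F` is
the iterate of this operation on tuples padded with `e`. -/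
theorem NAryNeutral.apply_getD_eq_foldr {X : Type*} {n : ℕ} (hn : 3 ≤ n)
    {F : (Fin n → X) → X} (hF : NAryAssociative n F) {e : X} (he : NAryNeutral n F e)
    (L : List X) (hL : L.length ≤ n) :
    F (fun i => L.getD i e) = L.foldr (fun a b => F fun i => [a, b].getD i e) e := by
  induction L with
  | nil =>
    have h := he e ⟨0, by omega⟩
    simpa using h
  | cons a L ih =>
    rw [List.foldr_cons, ← ih (by simp at hL; omega)]
    have h := hF (fun k => (a :: L).getD k e) 0 (by omega)
    have h0 : naryCompAt n F (fun k => (a :: L).getD k e) 0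
        = F (fun i => (a :: L).getD i e) := by
      rw [← he (F fun i => (a :: L).getD i e) ⟨0, by omega⟩]
      unfold naryCompAt
      congr 1
      ext j
      obtain ⟨_ | j, hj⟩ := j
      · simp
      · simpa using List.getD_eq_default (a :: L) e (by omega : (a :: L).length ≤ j + 1 + n - 1)
    rw [← h0, h]
    unfold naryCompAt
    congr 1
    ext j
    obtain ⟨_ | _ | j, hj⟩ := j
    · simp
    · simp [Nat.add_comm 1]
    · simpa using List.getD_eq_default (a :: L) e (by omega : (a :: L).length ≤ j + 1 + 1 + n - 1)

/-- An associative operation with a neutral element is the iterated product of a monoid. -/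
theorem NAryNeutral.exists_monoid {X : Type*} {n : ℕ} (hn : 3 ≤ n)
    {F : (Fin n → X) → X} (hF : NAryAssociative n F) {e : X} (he : NAryNeutral n F e) :
    ∃ _ : Monoid X, ∀ x : Fin n → X, F x = (List.ofFn x).prod := by
  let G : X → X → X := fun a b => F fun i => [a, b].getD i e
  have hfold : ∀ L : List X, L.length ≤ n → F (fun i => L.getD i e) = L.foldr G e :=
    he.apply_getD_eq_foldr hn hF
  have hright : ∀ a, G a e = a := fun a => by
    rw [← he a ⟨0, by omega⟩]
    refine congrArg F (funext fun j => ?_)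
    obtain ⟨_ | _ | j, hj⟩ := j <;> simp [he a]
  have hleft : ∀ a, G e a = a := fun a => by
    rw [← he a ⟨1, by omega⟩]
    refine congrArg F (funext fun j => ?_)
    obtain ⟨_ | _ | j, hj⟩ := j <;> simp [he a]
  have hpad : ∀ (k : ℕ) (b : X), (List.replicate k e).foldr G b = b := fun k b => by
    induction k with
    | zero => rfl
    | succ k ih => rw [List.replicate_succ, List.foldr_cons, ih, hleft]
  have hassoc : ∀ a b c, G (G a b) c = G a (G b c) := fun a b c => by
    let L := a :: b :: (List.replicate (n - 2) e ++ [c])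
    have hlen : L.length = n + 1 := by simp [L]; omega
    have h := hF (fun k => L.getD k e) 0 (by omega)
    have h0 : naryCompAt n F (fun k => L.getD k e) 0 = G (G a b) c := by
      refine congrArg F (funext fun j => ?_)
      obtain ⟨_ | _ | j, hj⟩ := j
      · simp only [Nat.not_lt_zero, if_false, if_true, List.getD_cons_zero]
        refine congrArg F (funext fun i => ?_)
        obtain ⟨_ | _ | i, hi⟩ := i
        · simp [L]
        · simp [L]
        · have : i < n - 2 := by omega
          simp [L, List.getElem?_append, this]
      · have : 0 + 1 + n - 1 = (n - 2) + 1 + 1 := by omega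
        simp only [this]
        simp [L]
      · simpa using List.getD_eq_default L e (by omega : L.length ≤ j + 1 + 1 + n - 1)
    have h1 : naryCompAt n F (fun k => L.getD k e) 1 = G a (G b c) := by
      have hbc : F (fun i => L.tail.getD i e) = G b c := by
        rw [hfold _ (by simp [hlen])]
        simp [L, hpad, hright]
      refine congrArg F (funext fun j => ?_)
      obtain ⟨_ | _ | j, hj⟩ := j
      · simp [L]
      · simpa [L, Nat.add_comm 1] using hbc
      · simpa using List.getD_eq_default L e (by omega : L.length ≤ j + 1 + 1 + n - 1)
    rw [← h0, h, h1]
  let _ : Monoid X :=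
    { mul := G, one := e, mul_assoc := hassoc, one_mul := hleft, mul_one := hright }
  refine ⟨inferInstance, fun x => ?_⟩
  refine Eq.trans (congrArg F (funext fun i => ?_)) (hfold (List.ofFn x) (by simp))
  simp

theorem prod_ofFn_update_const {M : Type*} [Monoid M] {n : ℕ} (f a : M) (p : Fin n) :
    (List.ofFn (Function.update (fun _ => f) p a)).prod
      = f ^ (p : ℕ) * (a * f ^ (n - 1 - (p : ℕ))) := by
  have : List.ofFn (Function.update (fun _ => f) p a)
      = List.replicate p f ++ a :: List.replicate (n - 1 - (p : ℕ)) f := by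
    refine List.ext_getElem (by simp; omega) fun i h1 h2 => ?_
    simp only [List.getElem_ofFn, Function.update_apply, Fin.ext_iff, List.getElem_append,
      List.getElem_cons, List.getElem_replicate, List.length_replicate]
    split_ifs <;> first | rfl | omega
  simp [this]

/-- The submonoid of central elements whose `k`-th power is `1`. -/
def centralTorsion (M : Type*) [Monoid M] (k : ℕ) : Submonoid M where
  carrier := {z | (∀ a, Commute z a) ∧ z ^ k = 1}
  one_mem' := ⟨Commute.one_left, one_pow k⟩
  mul_mem' := fun {a b} ha hb =>
    ⟨fun c => (ha.1 c).mul_left (hb.1 c), by rw [(ha.1 b).mul_pow, ha.2, hb.2, one_mul]⟩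

/-- The neutral elements of an iterated monoid product are the central elements whose
`(n - 1)`-th power is `1`. -/
theorem nAryNeutral_iff_mem_centralTorsion {M : Type*} [Monoid M] {n : ℕ} (hn : 2 ≤ n)
    {F : (Fin n → M) → M} (hF : ∀ x, F x = (List.ofFn x).prod) (f : M) :
    NAryNeutral n F f ↔ f ∈ centralTorsion M (n - 1) := by
  simp only [NAryNeutral, hF, prod_ofFn_update_const]
  constructor
  · intro h
    have h0 : f ^ (n - 1) = 1 := by simpa using h 1 ⟨0, by omega⟩
    refine ⟨fun a => ?_, h0⟩
    have h1 : f * (a * f ^ (n - 2)) = a := by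
      simpa [Nat.sub_sub] using h a ⟨1, by omega⟩
    have h2 : f ^ (n - 2) * f = 1 := by
      rw [← pow_succ, ← h0]
      congr 1
      omega
    calc f * a = f * (a * (f ^ (n - 2) * f)) := by rw [h2, mul_one]
      _ = f * (a * f ^ (n - 2)) * f := by simp only [mul_assoc]
      _ = a * f := by rw [h1]
  · rintro ⟨hc, h0⟩ a p
    have hp : (p : ℕ) + (n - 1 - p) = n - 1 := by omega
    rw [← mul_assoc, ((hc a).pow_left p).eq, mul_assoc, ← pow_add, hp, h0, mul_one]

/-- If `F` is associative with at least one neutral element, then `F` preserves `E_F`. -/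
theorem stmt_6 {X : Type*} [Nonempty X] (n : ℕ) (hn : 3 ≤ n)
    (F : (Fin n → X) → X) (hF : NAryAssociative n F)
    (hE : (naryNeutralSet n F).Nonempty) :
    ∀ e : Fin n → X, (∀ i, e i ∈ naryNeutralSet n F) → F e ∈ naryNeutralSet n F := by
  intro e he
  obtain ⟨u, hu⟩ := hE
  obtain ⟨_, hprod⟩ := NAryNeutral.exists_monoid hn hF hu
  have hiff := nAryNeutral_iff_mem_centralTorsion (by omega) hprod
  refine (hiff _).2 ?_
  rw [hprod]
  refine Submonoid.list_prod_mem _ fun y hy => ?_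
  obtain ⟨i, rfl⟩ := (List.mem_ofFn' e y).1 hy
  exact (hiff _).1 (he i)
end
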